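/- Any cut node of a weighted graph has nonpositive node resistance curvature, and a cut node has zero node resistance curvature if and only if its combinatorial degree equals two. -/

import Mathlib

open Matrix

variable {V : Type*}

/- The weighted Laplacian matrix of a weighted graph `(V, G, c)`:
`Q i i = ∑_{k ∼ i} c i k`, `Q i j = -c i j` for links `i ∼ j`, and `0` otherwise. -/
open Classical in
noncomputable def lapMatrix [Fintype V] (G : SimpleGraph V) (c : V → V → ℝ) :
    Matrix V V ℝ :=
  Matrix.of fun i j =>
    if i = j then ∑ k, if G.Adj i k then c i k else 0
    else if G.Adj i j then -c i j else 0

/- The four Penrose equations characterizing the Moore–Penrose pseudoinverse. -/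
def IsMoorePenroseInv [Fintype V] (Q Qd : Matrix V V ℝ) : Prop :=
  Q * Qd * Q = Q ∧ Qd * Q * Qd = Qd ∧ (Q * Qd)ᵀ = Q * Qd ∧ (Qd * Q)ᵀ = Qd * Q

/- The effective resistance `ω i j = (e_i - e_j)ᵀ Q† (e_i - e_j)`, computed from a
pseudoinverse `Qd` of the Laplacian. -/
open Classical in
noncomputable def effRes [Fintype V] (Qd : Matrix V V ℝ) (i j : V) : ℝ :=
  (Pi.single i 1 - Pi.single j 1) ⬝ᵥ Qd *ᵥ (Pi.single i 1 - Pi.single j 1)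

/- The node resistance curvature `p i = 1 - (1/2) ∑_{j ∼ i} c i j * ω i j`. -/
open Classical in
noncomputable def nodeCurv [Fintype V] (G : SimpleGraph V) (c : V → V → ℝ)
    (Qd : Matrix V V ℝ) (i : V) : ℝ :=
  1 - 1 / 2 * ∑ j, if G.Adj i j then c i j * effRes Qd i j else 0

/- A node `i` is a cut node if removing it (and its incident links) from its
connected component disconnects that component, i.e. leaves more than one
connected component. -/
def IsCutNode (G : SimpleGraph V) (i : V) : Prop :=
  1 < Nat.card (SimpleGraph.induce {v | G.Reachable i v ∧ v ≠ i} G).ConnectedComponent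

/-- The link weights, extended by zero to pairs of nodes that are not linked. -/
noncomputable def linkWeight (G : SimpleGraph V) (c : V → V → ℝ) (i j : V) : ℝ :=
  open Classical in if G.Adj i j then c i j else 0

section Laplacian

variable {G : SimpleGraph V} {c : V → V → ℝ}

lemma linkWeight_of_adj {i j : V} (h : G.Adj i j) : linkWeight G c i j = c i j := if_pos h

lemma linkWeight_of_not_adj {i j : V} (h : ¬G.Adj i j) : linkWeight G c i j = 0 := if_neg h

lemma linkWeight_comm (hsymm : ∀ i j, c i j = c j i) (i j : V) :
    linkWeight G c i j = linkWeight G c j i := by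
  by_cases h : G.Adj i j
  · rw [linkWeight_of_adj h, linkWeight_of_adj h.symm, hsymm]
  · rw [linkWeight_of_not_adj h, linkWeight_of_not_adj fun h' => h h'.symm]

lemma linkWeight_nonneg (hpos : ∀ i j, G.Adj i j → 0 < c i j) (i j : V) :
    0 ≤ linkWeight G c i j := by
  by_cases h : G.Adj i j
  · exact linkWeight_of_adj (c := c) h ▸ (hpos i j h).le
  · exact (linkWeight_of_not_adj h).ge

variable [Fintype V]

lemma lapMatrix_mulVec_apply (x : V → ℝ) (k : V) :
    (lapMatrix G c *ᵥ x) k = ∑ l, linkWeight G c k l * (x k - x l) := by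
  classical
  have entry (l : V) : lapMatrix G c k l =
      (if k = l then ∑ m, linkWeight G c k m else 0) - linkWeight G c k l := by
    by_cases h : k = l
    · subst h
      simp [lapMatrix, linkWeight]
    · by_cases h' : G.Adj k l <;> simp [lapMatrix, linkWeight, h, h']
  simp only [mulVec, dotProduct, entry, sub_mul, mul_sub, Finset.sum_sub_distrib, ite_mul,
    zero_mul, Finset.sum_ite_eq, Finset.mem_univ, if_true, Finset.sum_mul]

lemma lapMatrix_transpose (hsymm : ∀ i j, c i j = c j i) :
    (lapMatrix G c)ᵀ = lapMatrix G c := by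
  classical
  ext i j
  by_cases h : i = j
  · subst h
    rfl
  · simp [lapMatrix, h, Ne.symm h, G.adj_comm i j, hsymm i j]

lemma dotProduct_lapMatrix_mulVec_comm (hsymm : ∀ i j, c i j = c j i) (x y : V → ℝ) :
    x ⬝ᵥ lapMatrix G c *ᵥ y = y ⬝ᵥ lapMatrix G c *ᵥ x := by
  rw [dotProduct_mulVec, ← mulVec_transpose, lapMatrix_transpose hsymm, dotProduct_comm]

lemma dotProduct_lapMatrix_mulVec_self (hsymm : ∀ i j, c i j = c j i) (x : V → ℝ) :
    x ⬝ᵥ lapMatrix G c *ᵥ x = 1 / 2 * ∑ k, ∑ l, linkWeight G c k l * (x k - x l) ^ 2 := by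
  have left : x ⬝ᵥ lapMatrix G c *ᵥ x
      = ∑ k, ∑ l, x k * (linkWeight G c k l * (x k - x l)) := by
    simp only [dotProduct, lapMatrix_mulVec_apply, Finset.mul_sum]
  have swapped : x ⬝ᵥ lapMatrix G c *ᵥ x
      = ∑ k, ∑ l, x l * (linkWeight G c k l * (x l - x k)) := by
    rw [left, Finset.sum_comm]
    simp only [linkWeight_comm hsymm]
  have key : ∑ k, ∑ l, linkWeight G c k l * (x k - x l) ^ 2 =
      ∑ k, ∑ l, x k * (linkWeight G c k l * (x k - x l)) +
      ∑ k, ∑ l, x l * (linkWeight G c k l * (x l - x k)) := by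
    simp only [← Finset.sum_add_distrib]
    exact Finset.sum_congr rfl fun k _ => Finset.sum_congr rfl fun l _ => by ring
  linarith

lemma dotProduct_lapMatrix_mulVec_self_nonneg (hsymm : ∀ i j, c i j = c j i)
    (hpos : ∀ i j, G.Adj i j → 0 < c i j) (x : V → ℝ) :
    0 ≤ x ⬝ᵥ lapMatrix G c *ᵥ x := by
  rw [dotProduct_lapMatrix_mulVec_self hsymm]
  have := Finset.sum_nonneg fun k (_ : k ∈ Finset.univ) =>
    Finset.sum_nonneg fun l (_ : l ∈ Finset.univ) =>
      mul_nonneg (linkWeight_nonneg hpos k l) (sq_nonneg (x k - x l))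
  linarith

lemma linkWeight_mul_sub_eq_zero (hsymm : ∀ i j, c i j = c j i)
    (hpos : ∀ i j, G.Adj i j → 0 < c i j) {x : V → ℝ} (hx : x ⬝ᵥ lapMatrix G c *ᵥ x = 0)
    (k l : V) : linkWeight G c k l * (x k - x l) = 0 := by
  have nonneg (k l : V) : 0 ≤ linkWeight G c k l * (x k - x l) ^ 2 :=
    mul_nonneg (linkWeight_nonneg hpos k l) (sq_nonneg _)
  rw [dotProduct_lapMatrix_mulVec_self hsymm, mul_eq_zero_iff_left (by norm_num),
    Finset.sum_eq_zero_iff_of_nonneg fun k _ => Finset.sum_nonneg fun l _ => nonneg k l] at hx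
  have h := (Finset.sum_eq_zero_iff_of_nonneg fun l _ => nonneg k l).1
    (hx k (Finset.mem_univ k)) l (Finset.mem_univ l)
  simpa using h

lemma lapMatrix_mulVec_eq_zero (hsymm : ∀ i j, c i j = c j i)
    (hpos : ∀ i j, G.Adj i j → 0 < c i j) {x : V → ℝ} (hx : x ⬝ᵥ lapMatrix G c *ᵥ x = 0) :
    lapMatrix G c *ᵥ x = 0 := by
  ext k
  rw [lapMatrix_mulVec_apply]
  exact Finset.sum_eq_zero fun l _ => linkWeight_mul_sub_eq_zero hsymm hpos hx k l

/-- The dipole of a link lies in the range of the Laplacian. -/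
lemma lapMatrix_mulVec_pinv_mulVec_single_sub_single [DecidableEq V]
    (hsymm : ∀ i j, c i j = c j i) (hpos : ∀ i j, G.Adj i j → 0 < c i j) {Qd : Matrix V V ℝ}
    (hQd : IsMoorePenroseInv (lapMatrix G c) Qd) {i j : V} (hij : G.Adj i j) :
    lapMatrix G c *ᵥ (Qd *ᵥ (Pi.single i 1 - Pi.single j 1)) =
      Pi.single i 1 - Pi.single j 1 := by
  set b : V → ℝ := Pi.single i 1 - Pi.single j 1 with hb
  set Q := lapMatrix G c with hQ
  obtain ⟨h1, -, h3, -⟩ := hQd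
  set r := b - Q *ᵥ (Qd *ᵥ b) with hr
  have absorb : Q * (Q * Qd) = Q := by
    have h := congrArg transpose h1
    rwa [transpose_mul, h3, hQ, lapMatrix_transpose hsymm] at h
  have ker : Q *ᵥ r = 0 := by
    rw [hr, mulVec_sub, mulVec_mulVec, mulVec_mulVec, Matrix.mul_assoc, absorb, sub_self]
  have hrb : r ⬝ᵥ b = 0 := by
    have h := linkWeight_mul_sub_eq_zero hsymm hpos
      (show r ⬝ᵥ lapMatrix G c *ᵥ r = 0 by rw [← hQ, ker, dotProduct_zero]) i j
    rw [linkWeight_of_adj hij, mul_eq_zero_iff_left (hpos i j hij).ne'] at h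
    simpa [hb, dotProduct_sub] using h
  have hrr : r ⬝ᵥ r = 0 := by
    conv_lhs => rw [hr, dotProduct_sub, ← hr, hrb]
    rw [hQ, dotProduct_lapMatrix_mulVec_comm hsymm, ← hQ, ker, dotProduct_zero, sub_zero]
  exact (sub_eq_zero.1 (dotProduct_self_eq_zero.1 hrr)).symm

end Laplacian

/-- `C` does not contain `i`, and every link leaving `C` ends at `i`. -/
def IsLobe (G : SimpleGraph V) (i : V) (C : Finset V) : Prop :=
  i ∉ C ∧ ∀ k ∈ C, ∀ l, G.Adj k l → l ∉ C → l = i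

lemma IsLobe.compl_insert [Fintype V] [DecidableEq V] {G : SimpleGraph V} {i : V}
    {C : Finset V} (hC : IsLobe G i C) : IsLobe G i (insert i C)ᶜ := by
  refine ⟨by simp, fun k hk l hkl hl => ?_⟩
  rw [Finset.mem_compl, Finset.mem_insert, not_or] at hk
  rw [Finset.mem_compl, not_not, Finset.mem_insert] at hl
  rcases hl with hl | hl
  · exact hl
  · exact absurd (hC.2 l hl k hkl.symm hk.2) hk.1

lemma IsLobe.exists_adj {G : SimpleGraph V} {i u : V} {C : Finset V} (hC : IsLobe G i C)
    (hu : u ∈ C) (hiu : G.Reachable i u) : ∃ j ∈ C, G.Adj i j := by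
  obtain ⟨p⟩ := hiu.symm
  obtain ⟨d, -, hd1, hd2⟩ := p.exists_boundary_dart (C : Set V) (by simpa using hu)
    (by simpa using hC.1)
  have h := hC.2 d.fst hd1 d.snd d.adj hd2
  exact ⟨d.fst, hd1, h ▸ d.adj.symm⟩

lemma IsCutNode.exists_isLobe [Fintype V] [DecidableEq V] {G : SimpleGraph V} {i : V}
    (h : IsCutNode G i) : ∃ C : Finset V, IsLobe G i C ∧ (∃ j ∈ C, G.Adj i j) ∧
      ∃ j ∈ (insert i C)ᶜ, G.Adj i j := by
  classical
  unfold IsCutNode at h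
  have : Finite (SimpleGraph.induce {v | G.Reachable i v ∧ v ≠ i} G).ConnectedComponent :=
    Nat.finite_of_card_ne_zero (by omega)
  obtain ⟨a, b, hab⟩ := (Finite.one_lt_card_iff_nontrivial.1 h).exists_pair_ne
  induction a using SimpleGraph.ConnectedComponent.ind with | _ u
  induction b using SimpleGraph.ConnectedComponent.ind with | _ v
  have huv := fun h => hab (SimpleGraph.ConnectedComponent.eq.2 h)
  let C : Finset V := {x | ∃ hx : x ∈ {v | G.Reachable i v ∧ v ≠ i},
    (SimpleGraph.induce {v | G.Reachable i v ∧ v ≠ i} G).Reachable u ⟨x, hx⟩}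
  have hC : IsLobe G i C := by
    refine ⟨by simp [C], fun k hk l hkl hl => by_contra fun hli => hl ?_⟩
    simp only [C, Finset.mem_filter_univ] at hk ⊢
    obtain ⟨hk, hr⟩ := hk
    refine ⟨⟨hk.1.trans hkl.reachable, hli⟩, hr.trans (SimpleGraph.Adj.reachable ?_)⟩
    exact hkl
  have hu : u.1 ∈ C := by
    simp only [C, Finset.mem_filter_univ]
    exact ⟨u.2, .rfl⟩
  have hv : v.1 ∈ (insert i C)ᶜ := by
    simp only [C, Finset.mem_compl, Finset.mem_insert, Finset.mem_filter_univ, not_or]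
    exact ⟨v.2.2, fun ⟨_, h⟩ => huv h⟩
  exact ⟨C, hC, hC.exists_adj hu u.2.1, hC.compl_insert.exists_adj hv v.2.1⟩

section Lobe

variable [Fintype V] [DecidableEq V] {G : SimpleGraph V} {c : V → V → ℝ} {i : V} {C : Finset V}

lemma IsLobe.lapMatrix_mulVec_indicator (hsymm : ∀ i j, c i j = c j i) (hC : IsLobe G i C) :
    lapMatrix G c *ᵥ (fun v => if v ∈ C then 1 else 0) = fun m =>
      if m ∈ C then linkWeight G c i m
      else if m = i then -∑ k ∈ C, linkWeight G c i k else 0 := by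
  ext m
  rw [lapMatrix_mulVec_apply]
  split_ifs with hm hmi
  · rw [Finset.sum_eq_single i]
    · simp [hC.1, linkWeight_comm hsymm m i]
    · intro l _ hl
      by_cases hlC : l ∈ C
      · simp [hlC]
      · rw [linkWeight_of_not_adj fun h => hl (hC.2 m hm l h hlC), zero_mul]
    · simp
  · subst hmi
    simp
  · refine Finset.sum_eq_zero fun l _ => ?_
    by_cases hlC : l ∈ C
    · rw [linkWeight_of_not_adj fun h => hmi (hC.2 l hlC m h.symm hm), zero_mul]
    · simp [hlC]

lemma IsLobe.effRes_bounds (hsymm : ∀ i j, c i j = c j i)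
    (hpos : ∀ i j, G.Adj i j → 0 < c i j) {Qd : Matrix V V ℝ}
    (hQd : IsMoorePenroseInv (lapMatrix G c) Qd) (hC : IsLobe G i C) {j : V} (hj : j ∈ C)
    (hij : G.Adj i j) :
    (∑ k ∈ C, linkWeight G c i k)⁻¹ ≤ effRes Qd i j ∧
      ((∑ k ∈ C, linkWeight G c i k)⁻¹ = effRes Qd i j ↔
        ∀ k ∈ C, G.Adj i k → k = j) := by
  have hQf := hC.lapMatrix_mulVec_indicator (c := c) hsymm
  set f : V → ℝ := fun v => if v ∈ C then 1 else 0 with hf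
  set d := ∑ k ∈ C, linkWeight G c i k with hd
  have hd0 : 0 < d := Finset.sum_pos' (fun k _ => linkWeight_nonneg hpos i k)
    ⟨j, hj, linkWeight_of_adj (c := c) hij ▸ hpos i j hij⟩
  set b : V → ℝ := Pi.single i 1 - Pi.single j 1 with hb
  have hω : effRes Qd i j = b ⬝ᵥ Qd *ᵥ b := by
    unfold effRes
    congr!
  set g := Qd *ᵥ b
  have hQg : lapMatrix G c *ᵥ g = b :=
    lapMatrix_mulVec_pinv_mulVec_single_sub_single hsymm hpos hQd hij
  have hff : f ⬝ᵥ lapMatrix G c *ᵥ f = d := by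
    rw [hQf, hd]
    simp only [dotProduct, hf, ite_mul, one_mul, zero_mul, Finset.sum_ite_mem, Finset.univ_inter]
    exact Finset.sum_congr rfl fun k hk => if_pos hk
  have hfg : f ⬝ᵥ lapMatrix G c *ᵥ g = -1 := by
    rw [hQg, hb]
    simp [dotProduct_sub, hf, hj, hC.1]
  have hgf : g ⬝ᵥ lapMatrix G c *ᵥ f = -1 := by
    rw [dotProduct_lapMatrix_mulVec_comm hsymm, hfg]
  have energy : (g + d⁻¹ • f) ⬝ᵥ lapMatrix G c *ᵥ (g + d⁻¹ • f) = effRes Qd i j - d⁻¹ := by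
    have hgg : g ⬝ᵥ lapMatrix G c *ᵥ g = effRes Qd i j := by
      rw [hQg, hω, dotProduct_comm]
    simp only [mulVec_add, mulVec_smul, dotProduct_add, add_dotProduct, dotProduct_smul,
      smul_dotProduct, smul_eq_mul, hgg, hgf, hfg, hff]
    field_simp
    ring
  refine ⟨by linarith [dotProduct_lapMatrix_mulVec_self_nonneg hsymm hpos (g + d⁻¹ • f)],
    fun heq k hk hik => by_contra fun hkj => ?_, fun huniq => ?_⟩
  · have ker := congrFun (lapMatrix_mulVec_eq_zero hsymm hpos
      (energy.trans (sub_eq_zero.2 heq.symm))) k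
    have hki : k ≠ i := hik.ne'
    rw [mulVec_add, mulVec_smul, hQg, hQf] at ker
    simp [hb, hki, hkj, hk, hd0.ne', linkWeight_of_adj hik, (hpos i k hik).ne'] at ker
  · have hother (k : V) (hk : k ∈ C) (hkj : k ≠ j) : linkWeight G c i k = 0 :=
      linkWeight_of_not_adj fun h => hkj (huniq k hk h)
    have hdj : d = linkWeight G c i j :=
      Finset.sum_eq_single_of_mem j hj hother
    have hQfb : lapMatrix G c *ᵥ f = -d • b := by
      rw [hQf]
      ext m
      by_cases hmj : m = j
      · subst hmj
        simp [hb, hj, hij.ne', hdj]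
      · by_cases hmi : m = i
        · subst hmi
          simp [hb, hC.1, hmj]
        · by_cases hm : m ∈ C
          · simp [hb, hm, hmi, hmj, hother m hm hmj]
          · simp [hb, hm, hmi, hmj]
    rw [hQfb, dotProduct_smul, dotProduct_comm, ← hω, smul_eq_mul] at hgf
    exact inv_eq_of_mul_eq_one_right (by linarith)

/-- Each lobe contributes at least one to the sum of relative resistances at `i`, with equality
exactly when it is attached by a single link. -/
lemma IsLobe.sum_bounds [DecidableRel G.Adj] (hsymm : ∀ i j, c i j = c j i)
    (hpos : ∀ i j, G.Adj i j → 0 < c i j) {Qd : Matrix V V ℝ}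
    (hQd : IsMoorePenroseInv (lapMatrix G c) Qd) (hC : IsLobe G i C) (hne : ∃ j ∈ C, G.Adj i j) :
    1 ≤ ∑ j ∈ C, linkWeight G c i j * effRes Qd i j ∧
      (∑ j ∈ C, linkWeight G c i j * effRes Qd i j = 1 ↔ (C.filter (G.Adj i)).card = 1) := by
  obtain ⟨j, hj, hij⟩ := hne
  have hd0 : 0 < ∑ k ∈ C, linkWeight G c i k :=
    Finset.sum_pos' (fun k _ => linkWeight_nonneg hpos i k)
      ⟨j, hj, linkWeight_of_adj (c := c) hij ▸ hpos i j hij⟩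
  have hone : ∑ j ∈ C, linkWeight G c i j * (∑ k ∈ C, linkWeight G c i k)⁻¹ = 1 := by
    rw [← Finset.sum_mul, mul_inv_cancel₀ hd0.ne']
  have hle (k : V) (hk : k ∈ C) : linkWeight G c i k * (∑ l ∈ C, linkWeight G c i l)⁻¹ ≤
      linkWeight G c i k * effRes Qd i k := by
    by_cases hik : G.Adj i k
    · exact mul_le_mul_of_nonneg_left (hC.effRes_bounds hsymm hpos hQd hk hik).1
        (linkWeight_nonneg hpos i k)
    · simp [linkWeight_of_not_adj hik]
  refine ⟨hone ▸ Finset.sum_le_sum hle, ?_⟩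
  rw [eq_comm]
  nth_rw 1 [← hone]
  rw [Finset.sum_eq_sum_iff_of_le hle, Finset.card_eq_one]
  have hiff {k : V} (hk : k ∈ C) (hik : G.Adj i k) :
      linkWeight G c i k * (∑ l ∈ C, linkWeight G c i l)⁻¹ =
        linkWeight G c i k * effRes Qd i k ↔ ∀ l ∈ C, G.Adj i l → l = k := by
    rw [mul_right_inj' (linkWeight_of_adj (c := c) hik ▸ (hpos i k hik).ne'),
      (hC.effRes_bounds hsymm hpos hQd hk hik).2]
  constructor
  · intro h
    refine ⟨j, Finset.eq_singleton_iff_unique_mem.2 ⟨Finset.mem_filter.2 ⟨hj, hij⟩, ?_⟩⟩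
    intro k hk
    exact (hiff hj hij).1 (h j hj) k (Finset.mem_filter.1 hk).1 (Finset.mem_filter.1 hk).2
  · rintro ⟨a, ha⟩ k hk
    have mem {l : V} (hl : l ∈ C) (hil : G.Adj i l) : l = a :=
      Finset.mem_singleton.1 (ha ▸ Finset.mem_filter.2 ⟨hl, hil⟩)
    by_cases hik : G.Adj i k
    · exact (hiff hk hik).2 fun l hl hil => (mem hl hil).trans (mem hk hik).symm
    · simp [linkWeight_of_not_adj hik]

end Lobe

/- STATEMENT 8: a cut node has nonpositive node resistance curvature, with zero
curvature if and only if its combinatorial degree is two. -/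
theorem cutNode_nodeCurv_nonpos
    [Fintype V] [DecidableEq V] (G : SimpleGraph V) [DecidableRel G.Adj]
    (c : V → V → ℝ) (hsymm : ∀ i j, c i j = c j i)
    (hpos : ∀ i j, G.Adj i j → 0 < c i j)
    (Qd : Matrix V V ℝ) (hQd : IsMoorePenroseInv (lapMatrix G c) Qd)
    (i : V) (hcut : IsCutNode G i) :
    nodeCurv G c Qd i ≤ 0 ∧ (nodeCurv G c Qd i = 0 ↔ G.degree i = 2) := by
  obtain ⟨C, hC, hCne, hDne⟩ := hcut.exists_isLobe
  obtain ⟨hC1, hCeq⟩ := hC.sum_bounds hsymm hpos hQd hCne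
  obtain ⟨hD1, hDeq⟩ := hC.compl_insert.sum_bounds hsymm hpos hQd hDne
  have hcurv : nodeCurv G c Qd i = 1 - 1 / 2 *
      (∑ j ∈ C, linkWeight G c i j * effRes Qd i j +
        ∑ j ∈ (insert i C)ᶜ, linkWeight G c i j * effRes Qd i j) := by
    have hsum := Finset.sum_add_sum_compl (insert i C)
      fun j => linkWeight G c i j * effRes Qd i j
    rw [Finset.sum_insert hC.1, linkWeight_of_not_adj G.irrefl, zero_mul, zero_add] at hsum
    rw [hsum]
    simp only [nodeCurv, linkWeight, ite_mul, zero_mul]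
    congr!
  have hdeg : G.degree i = (C.filter (G.Adj i)).card +
      ((insert i C)ᶜ.filter (G.Adj i)).card := by
    have hcard := Finset.sum_add_sum_compl (insert i C) fun j => if G.Adj i j then 1 else 0
    rw [Finset.sum_insert hC.1, if_neg G.irrefl, zero_add] at hcard
    rw [Finset.card_filter, Finset.card_filter, hcard, ← Finset.card_filter,
      ← G.card_neighborFinset_eq_degree, G.neighborFinset_eq_filter]
  have hcardpos {D : Finset V} : (∃ j ∈ D, G.Adj i j) → 0 < (D.filter (G.Adj i)).card :=
    fun ⟨j, hj, hij⟩ => Finset.card_pos.2 ⟨j, Finset.mem_filter.2 ⟨hj, hij⟩⟩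
  have hC0 := hcardpos hCne
  have hD0 := hcardpos hDne
  rw [hcurv]
  refine ⟨by linarith, fun h => ?_, fun h => ?_⟩
  · rw [hdeg, hCeq.1 (by linarith), hDeq.1 (by linarith)]
  · rw [hCeq.2 (by omega), hDeq.2 (by omega)]
    norm_num
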